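/- Let G be a finite group of size at least 2 and A a finite set of size at least 2, let M be the monoid of all G-equivariant self-maps of A^G under composition, and let R = {σ ∈ M : G_{σ(x)} = G_x for all x ∈ A^G}. Then R is not a maximal regular submonoid of M: there exists a submonoid K of M with R strictly contained in K, K strictly contained in M, and K von Neumann regular (every τ ∈ K admits φ ∈ K with τ(φ(τ x)) = τ x for all x). -/

import Mathlib

/-- The right action of `G` on the configuration space `A^G`:
`(x · g)(h) = x (h * g⁻¹)`. -/
def confShift {G A : Type*} [Group G] (x : G → A) (g : G) : G → A :=
  fun h => x (h * g⁻¹)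

/-- A self-map of `A^G` is `G`-equivariant if it commutes with the shift action. -/
def Equivariant {G A : Type*} [Group G] (τ : (G → A) → (G → A)) : Prop :=
  ∀ (x : G → A) (g : G), τ (confShift x g) = confShift (τ x) g

/-- The stabiliser of a configuration `x ∈ A^G`: `{g ∈ G : x · g = x}`. -/
def confStab {G A : Type*} [Group G] (x : G → A) : Set G :=
  {g : G | confShift x g = x}

/-- Membership in the submonoid `R`: `σ` is `G`-equivariant and preserves stabilisers. -/
def MemR {G A : Type*} [Group G] (σ : (G → A) → (G → A)) : Prop :=
  Equivariant σ ∧ ∀ x : G → A, confStab (σ x) = confStab x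

theorem cs_mul {G A : Type*} [Group G] (x : G → A) (a b : G) :
    confShift (confShift x a) b = confShift x (a * b) := by
  funext h; simp [confShift, mul_assoc]

theorem cs_one {G A : Type*} [Group G] (x : G → A) : confShift x 1 = x := by
  funext h; simp [confShift]

theorem cs_eq_iff {G A : Type*} [Group G] (x : G → A) (a b : G) :
    confShift x a = confShift x b ↔ a * b⁻¹ ∈ confStab x := by
  constructor
  · intro h
    show confShift x (a * b⁻¹) = x
    rw [← cs_mul, h, cs_mul, mul_inv_cancel, cs_one]
  · intro h
    have h' : confShift x (a * b⁻¹) = x := h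
    conv_rhs => rw [← h', cs_mul]
    simp

theorem exists_rep (G A : Type*) [Group G] :
    ∃ r : (G → A) → (G → A), (∀ y, ∃ g, confShift (r y) g = y) ∧
      ∀ y g, r (confShift y g) = r y := by
  let s : Setoid (G → A) :=
    { r := fun x y => ∃ g, confShift x g = y
      iseqv := ⟨fun x => ⟨1, cs_one x⟩,
        fun {x y} ⟨g, h⟩ => ⟨g⁻¹, by rw [← h, cs_mul, mul_inv_cancel, cs_one]⟩,
        fun {x y z} ⟨g, h⟩ ⟨k, h'⟩ => ⟨g * k, by rw [← cs_mul, h, h']⟩⟩ }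
  refine ⟨fun y => (Quotient.mk s y).out, fun y => ?_, fun y g => ?_⟩
  · exact Quotient.exact (Quotient.out_eq (Quotient.mk s y))
  · have : Quotient.mk s (confShift y g) = Quotient.mk s y :=
      Quotient.sound (s.symm ⟨g, rfl⟩)
    simp only [this]

theorem R_regular {G A : Type*} [Group G] (τ : (G → A) → (G → A)) (hτ : MemR τ) :
    ∃ φ, MemR φ ∧ ∀ x, τ (φ (τ x)) = τ x := by
  classical
  obtain ⟨r, hr, hrg⟩ := exists_rep G A
  choose g hg using hr
  obtain ⟨he, hs⟩ := hτ
  let φ : (G → A) → (G → A) := fun y =>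
    if h : ∃ x, τ x = r y then confShift h.choose (g y) else y
  have h1 : ∀ y, (∃ x, τ x = r y) → τ (φ y) = y := by
    intro y h
    simp only [φ, dif_pos h]
    rw [he, h.choose_spec, hg]
  refine ⟨φ, ⟨?_, ?_⟩, ?_⟩
  · intro y k
    by_cases h : ∃ x, τ x = r y
    · have e : φ (confShift y k) = confShift h.choose (g (confShift y k)) := by
        simp only [φ, hrg, dif_pos h]
      rw [e]
      simp only [φ, dif_pos h]
      rw [cs_mul, cs_eq_iff, ← hs, h.choose_spec, ← cs_eq_iff, ← cs_mul, hg,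
        ← hrg y k, hg]
    · simp only [φ, hrg, dif_neg h]
  · intro y
    by_cases h : ∃ x, τ x = r y
    · rw [← hs, h1 y h]
    · simp only [φ, dif_neg h]
  · intro x
    apply h1
    refine ⟨confShift x (g (τ x))⁻¹, ?_⟩
    rw [he]
    have e := cs_mul (r (τ x)) (g (τ x)) (g (τ x))⁻¹
    rwa [hg, mul_inv_cancel, cs_one] at e

/-- for finite `G` and `A`, both of size at least 2, the regular
submonoid `R` is not maximal regular in the monoid `M` of `G`-equivariant self-maps
of `A^G`: there is a von Neumann regular submonoid `K` with `R ⊊ K ⊊ M`. -/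
theorem stmt_11 {G A : Type*} [Group G] [Finite G] [Finite A]
    [Nontrivial G] [Nontrivial A] :
    ∃ K : Set ((G → A) → (G → A)),
      (id : (G → A) → (G → A)) ∈ K ∧
      (∀ τ ∈ K, ∀ σ ∈ K, σ ∘ τ ∈ K) ∧
      {σ : (G → A) → (G → A) | MemR σ} ⊂ K ∧
      K ⊂ {σ : (G → A) → (G → A) | Equivariant σ} ∧
      (∀ τ ∈ K, ∃ φ ∈ K, ∀ x : G → A, τ (φ (τ x)) = τ x) := by
  classical
  obtain ⟨a, b, hab⟩ := exists_pair_ne A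
  obtain ⟨u, hu⟩ := exists_ne (1 : G)
  let C : (G → A) → Prop := fun x => ∀ k, confShift x k = x
  let p : G → A := fun h => if h = 1 then a else b
  have hp : ¬ C p := by
    intro h
    have := congrFun (h u) u
    simp [confShift, p, hu, hab] at this
  have hC : ∀ c : A, C (fun _ => c) := fun c k => rfl
  have hCs : ∀ x k, C (confShift x k) ↔ C x := by
    intro x k
    constructor
    · intro h
      have h1 : x = confShift x k := by
        have := h k⁻¹
        rwa [cs_mul, mul_inv_cancel, cs_one] at this
      rw [h1]; exact h
    · intro h; rw [h k]; exact h
  have hCR : ∀ σ, MemR σ → ∀ x, C (σ x) → C x := by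
    intro σ hσ x h k
    have : k ∈ confStab (σ x) := h k
    rw [hσ.2] at this; exact this
  have hE : ∀ σ : (G → A) → (G → A), Equivariant σ → ∀ x, C x → C (σ x) := by
    intro σ hσ x h k
    rw [← hσ, h k]
  let K : Set ((G → A) → (G → A)) := {σ | MemR σ ∨ ∃ c, C c ∧ σ = fun _ => c}
  have hKE : ∀ σ ∈ K, Equivariant σ := by
    rintro σ (h | ⟨c, hc, rfl⟩)
    · exact h.1
    · intro x k; exact (hc k).symm
  refine ⟨K, Or.inl ⟨fun _ _ => rfl, fun _ => rfl⟩, ?_, ?_, ?_, ?_⟩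
  · rintro τ (hτ | ⟨c, hc, rfl⟩) σ hσ
    · rcases hσ with hσ | ⟨c, hc, rfl⟩
      · left
        refine ⟨fun x k => ?_, fun x => ?_⟩
        · simp only [Function.comp, hτ.1 x k, hσ.1 _ k]
        · simp only [Function.comp, hσ.2, hτ.2]
      · exact Or.inr ⟨c, hc, rfl⟩
    · exact Or.inr ⟨σ c, hE σ (hKE σ hσ) c hc, rfl⟩
  · refine (Set.ssubset_iff_of_subset fun σ h => Or.inl h).2
      ⟨fun _ => fun _ => a, Or.inr ⟨_, hC a, rfl⟩, fun h => hp (hCR _ h p (hC a))⟩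
  · refine (Set.ssubset_iff_of_subset hKE).2 ⟨fun x => if C x then x else fun _ => a, ?_, ?_⟩
    · intro x k
      by_cases h : C x
      · simp only [hCs, h, if_true]
      · simp only [hCs, h, if_false]; rfl
    · rintro (h | ⟨c, hc, h⟩)
      · apply hp
        apply hCR _ h
        simp only [hp, if_false]; exact hC a
      · have h1 := congrFun h (fun _ => a)
        have h2 := congrFun h (fun _ => b)
        simp only [hC, if_true] at h1 h2
        exact hab (congrFun (h1.trans h2.symm) 1)
  · rintro τ (hτ | ⟨c, hc, rfl⟩)
    · obtain ⟨φ, h, h'⟩ := R_regular τ hτ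
      exact ⟨φ, Or.inl h, h'⟩
    · exact ⟨fun _ => c, Or.inr ⟨c, hc, rfl⟩, fun _ => rfl⟩
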